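/- Let s and p be natural numbers with 0 < p < s, let μ : Fin s → ℝ and σ : Fin s → ℝ with σ_i > 0 for all i, let P be the product measure on Fin s → ℝ whose i-th factor is the real Gaussian measure with mean μ_i and variance σ_i², and let K ⊆ Fin s with |K| = p. Then the P-probability of the event {z | min_{i∈K} z_i > max_{j∉K} z_j} equals ∫_ℝ [∏_{i∈K} (1 − Φ((v − μ_i)/σ_i))] · [∑_{j∉K} (1/σ_j) φ((v − μ_j)/σ_j) ∏_{ℓ∉K, ℓ≠j} Φ((v − μ_ℓ)/σ_ℓ)] dv, where Φ and φ are the cumulative distribution function and density of the standard real Gaussian. -/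

import Mathlib

open MeasureTheory ProbabilityTheory

/-- Standard Gaussian density `φ`. -/
noncomputable def stdGaussPDF (u : ℝ) : ℝ :=
  (Real.sqrt (2 * Real.pi))⁻¹ * Real.exp (-(u ^ 2) / 2)

/-- Standard Gaussian cumulative distribution function `Φ`. -/
noncomputable def stdGaussCDF (t : ℝ) : ℝ :=
  ∫ u in Set.Iic t, stdGaussPDF u

lemma aux_pdf_std (u : ℝ) : gaussianPDFReal 0 1 u = stdGaussPDF u := by
  simp [gaussianPDFReal, stdGaussPDF]

lemma aux_pdf (m s : ℝ) (hs : 0 < s) (v : ℝ) :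
    gaussianPDFReal m (Real.toNNReal (s ^ 2)) v = (1 / s) * stdGaussPDF ((v - m) / s) := by
  have h1 : Real.sqrt (2 * Real.pi * s ^ 2) = Real.sqrt (2 * Real.pi) * s := by
    rw [Real.sqrt_mul (by positivity), Real.sqrt_sq hs.le]
  have h2 : -(v - m) ^ 2 / (2 * s ^ 2) = -(((v - m) / s) ^ 2) / 2 := by
    field_simp
  rw [gaussianPDFReal, stdGaussPDF, Real.coe_toNNReal _ (by positivity), h1, h2, mul_inv]
  ring

lemma aux_cdf_std (t : ℝ) : gaussianReal 0 1 (Set.Iic t) = ENNReal.ofReal (stdGaussCDF t) := by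
  rw [gaussianReal_apply_eq_integral 0 one_ne_zero]
  simp only [aux_pdf_std, stdGaussCDF]

lemma aux_cdf_nonneg (t : ℝ) : 0 ≤ stdGaussCDF t := by
  apply integral_nonneg
  intro u
  simp only [stdGaussPDF, Pi.zero_apply]
  positivity

lemma aux_cdf_eq (t : ℝ) : stdGaussCDF t = cdf (gaussianReal 0 1) t := by
  rw [cdf_eq_real, Measure.real, aux_cdf_std, ENNReal.toReal_ofReal (aux_cdf_nonneg t)]

lemma aux_cdf_le_one (t : ℝ) : stdGaussCDF t ≤ 1 := by
  rw [aux_cdf_eq]; exact cdf_le_one _ _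

lemma aux_cdf_meas : Measurable stdGaussCDF := by
  have : stdGaussCDF = cdf (gaussianReal 0 1) := funext aux_cdf_eq
  rw [this]
  exact (monotone_cdf _).measurable

lemma aux_Iic (m s : ℝ) (hs : 0 < s) (v : ℝ) :
    gaussianReal m (Real.toNNReal (s ^ 2)) (Set.Iic v)
      = ENNReal.ofReal (stdGaussCDF ((v - m) / s)) := by
  have h : gaussianReal m (Real.toNNReal (s ^ 2))
      = ((gaussianReal 0 1).map (fun x => s * x)).map (fun x => x + m) := by
    rw [gaussianReal_map_const_mul, gaussianReal_map_add_const]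
    congr 1
    · simp
    · ext; simp [Real.coe_toNNReal _ (sq_nonneg s)]
  rw [h, Measure.map_apply (by fun_prop) measurableSet_Iic,
    Measure.map_apply (by fun_prop) (measurableSet_Iic.preimage (by fun_prop)), ← aux_cdf_std]
  congr 1
  ext x
  simp only [Set.mem_preimage, Set.mem_Iic]
  rw [le_div_iff₀ hs]
  constructor <;> intro h <;> linarith

lemma aux_var_ne (s : ℝ) (hs : 0 < s) : Real.toNNReal (s ^ 2) ≠ 0 := by
  have : 0 < s ^ 2 := by positivity
  exact (Real.toNNReal_pos.2 this).ne'

lemma aux_Iio (m s : ℝ) (hs : 0 < s) (v : ℝ) :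
    gaussianReal m (Real.toNNReal (s ^ 2)) (Set.Iio v)
      = ENNReal.ofReal (stdGaussCDF ((v - m) / s)) := by
  have := nullSingletonClass_gaussianReal (μ := m) (aux_var_ne s hs)
  rw [← aux_Iic m s hs v]
  exact measure_congr Iio_ae_eq_Iic

lemma aux_Ioi (m s : ℝ) (hs : 0 < s) (v : ℝ) :
    gaussianReal m (Real.toNNReal (s ^ 2)) (Set.Ioi v)
      = ENNReal.ofReal (1 - stdGaussCDF ((v - m) / s)) := by
  rw [← Set.compl_Iic, prob_compl_eq_one_sub measurableSet_Iic, aux_Iic m s hs,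
    ENNReal.ofReal_sub _ (aux_cdf_nonneg _), ENNReal.ofReal_one]

lemma aux_section {n : ℕ} (ν : Fin (n + 1) → Measure ℝ) [∀ i, IsProbabilityMeasure (ν i)]
    (j : Fin (n + 1)) (S : Fin (n + 1) → ℝ → Set ℝ)
    (hm : MeasurableSet {z : Fin (n + 1) → ℝ | ∀ l, l ≠ j → z l ∈ S l (z j)}) :
    Measure.pi ν {z : Fin (n + 1) → ℝ | ∀ l, l ≠ j → z l ∈ S l (z j)}
      = ∫⁻ v, ∏ l ∈ Finset.univ.erase j, ν l (S l v) ∂(ν j) := by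
  have hmp := (measurePreserving_piFinSuccAbove ν j).symm
  rw [← hmp.measure_preimage hm.nullMeasurableSet,
    Measure.prod_apply (hm.preimage hmp.measurable)]
  apply lintegral_congr
  intro v
  have h1 : Finset.univ.erase j = Finset.univ.map (Fin.succAboveEmb j) := by
    ext l
    simp [Fin.exists_succAbove_eq_iff]
  rw [h1, Finset.prod_map, ← Measure.pi_pi]
  simp only [Fin.coe_succAboveEmb]
  congr 1
  ext w
  simp only [Set.mem_preimage, Set.mem_ofPred_eq, Set.mem_pi, Set.mem_univ, true_imp_iff]
  constructor
  · intro h k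
    simpa using h (j.succAbove k) (Fin.succAbove_ne j k)
  · intro h l hl
    obtain ⟨k, rfl⟩ := Fin.exists_succAbove_eq hl
    simpa using h k

/-- Under the product Gaussian measure, the probability that
`min_{i∈K} z i > max_{j∉K} z j` equals the one-dimensional integral
`∫ℝ [∏_{i∈K}(1 − Φ((v−μ i)/σ i))]·[∑_{j∉K}(1/σ j)φ((v−μ j)/σ j)∏_{ℓ∉K,ℓ≠j}Φ((v−μ ℓ)/σ ℓ)] dv`. -/
theorem prob_min_gt_max_eq_integral {s p : ℕ} (hp : 0 < p) (hps : p < s)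
    (μ σ : Fin s → ℝ) (hσ : ∀ i, 0 < σ i)
    (K : Finset (Fin s)) (hK : K.card = p)
    (hKne : K.Nonempty) (hKcne : Kᶜ.Nonempty) :
    ((Measure.pi fun i => gaussianReal (μ i) (Real.toNNReal ((σ i) ^ 2)))
        {z : Fin s → ℝ | K.inf' hKne z > Kᶜ.sup' hKcne z}).toReal
      =
    ∫ v : ℝ,
      (∏ i ∈ K, (1 - stdGaussCDF ((v - μ i) / σ i))) *
      (∑ j ∈ Kᶜ, (1 / σ j) * stdGaussPDF ((v - μ j) / σ j) *
        ∏ ℓ ∈ Kᶜ.erase j, stdGaussCDF ((v - μ ℓ) / σ ℓ)) := by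
  obtain ⟨n, rfl⟩ : ∃ n, s = n + 1 := ⟨s - 1, by omega⟩
  set ν : Fin (n + 1) → Measure ℝ :=
    fun i => gaussianReal (μ i) (Real.toNNReal ((σ i) ^ 2)) with hν
  let S : Fin (n + 1) → Fin (n + 1) → ℝ → Set ℝ := fun j l v =>
    if l ∈ K then Set.Ioi v else if l < j then Set.Iio v else Set.Iic v
  let E : Fin (n + 1) → Set (Fin (n + 1) → ℝ) := fun j => {z | ∀ l, l ≠ j → z l ∈ S j l (z j)}
  let g : Fin (n + 1) → ℝ → ℝ := fun j v =>
    (∏ i ∈ K, (1 - stdGaussCDF ((v - μ i) / σ i))) *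
      ((1 / σ j) * stdGaussPDF ((v - μ j) / σ j) *
        ∏ l ∈ Kᶜ.erase j, stdGaussCDF ((v - μ l) / σ l))
  have hpdf : ∀ u, 0 ≤ stdGaussPDF u := fun u => by
    rw [← aux_pdf_std]; exact gaussianPDFReal_nonneg _ _ _
  have hg0 : ∀ j v, 0 ≤ g j v := by
    intro j v
    have := hσ j
    refine mul_nonneg (Finset.prod_nonneg fun i _ => sub_nonneg.2 (aux_cdf_le_one _))
      (mul_nonneg (mul_nonneg (by positivity) (hpdf _))
        (Finset.prod_nonneg fun i _ => aux_cdf_nonneg _))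
  have hpm : Measurable stdGaussPDF := by unfold stdGaussPDF; fun_prop
  have hcm := aux_cdf_meas
  have hgm : ∀ j, Measurable (g j) := by
    intro j
    simp only [g]
    fun_prop
  have hEm : ∀ j, MeasurableSet (E j) := by
    intro j
    have : E j = ⋂ l, ⋂ (_ : l ≠ j), {z | z l ∈ S j l (z j)} := by
      ext z; simp [E]
    rw [this]
    refine MeasurableSet.iInter fun l => MeasurableSet.iInter fun _ => ?_
    simp only [S]
    split_ifs
    · exact measurableSet_lt (measurable_pi_apply j) (measurable_pi_apply l)
    · exact measurableSet_lt (measurable_pi_apply l) (measurable_pi_apply j)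
    · exact measurableSet_le (measurable_pi_apply l) (measurable_pi_apply j)
  have hset : {z : Fin (n + 1) → ℝ | K.inf' hKne z > Kᶜ.sup' hKcne z} = ⋃ j ∈ Kᶜ, E j := by
    ext z
    simp only [Set.mem_ofPred_eq, Set.mem_iUnion, gt_iff_lt, Finset.sup'_lt_iff,
      Finset.lt_inf'_iff, exists_prop]
    constructor
    · intro h
      obtain ⟨j0, hj0, hmax⟩ := Finset.exists_max_image Kᶜ z hKcne
      have hne : (Kᶜ.filter fun j => z j = z j0).Nonempty := ⟨j0, by simp [Finset.mem_compl.1 hj0]⟩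
      have hjm := Finset.min'_mem _ hne
      have hmin : ∀ l ∈ Kᶜ.filter fun j => z j = z j0, Finset.min' _ hne ≤ l :=
        fun l hl => Finset.min'_le _ l hl
      set j := (Kᶜ.filter fun j => z j = z j0).min' hne
      rw [Finset.mem_filter] at hjm
      refine ⟨j, hjm.1, fun l hl => ?_⟩
      simp only [S]
      split_ifs with h1 h2
      · exact h l h1 j hjm.1
      · have h3 := hmax l (Finset.mem_compl.2 h1)
        rw [Set.mem_Iio, hjm.2]
        refine lt_of_le_of_ne h3 fun h4 => ?_
        exact absurd (hmin l (Finset.mem_filter.2 ⟨Finset.mem_compl.2 h1, h4⟩)) (not_le.2 h2)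
      · rw [Set.mem_Iic, hjm.2]
        exact hmax l (Finset.mem_compl.2 h1)
    · rintro ⟨j, hj, hz⟩ i hi l hl
      have hjK := Finset.mem_compl.1 hj
      have h1 := hz i (fun h => hjK (h ▸ hi))
      simp only [S, if_pos hi, Set.mem_Ioi] at h1
      refine lt_of_le_of_lt ?_ h1
      by_cases hlj : l = j
      · rw [hlj]
      · have h2 := hz l hlj
        simp only [S, if_neg (Finset.mem_compl.1 hl)] at h2
        split_ifs at h2
        · exact le_of_lt h2
        · exact h2
  have hdisj : Set.PairwiseDisjoint (↑(Kᶜ) : Set (Fin (n + 1))) E := by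
    have key : ∀ a ∈ Kᶜ, ∀ b ∈ Kᶜ, a < b → ∀ z, z ∈ E a → z ∈ E b → False := by
      intro a ha b hb hab z hza hzb
      have h1 := hza b hab.ne'
      have h2 := hzb a hab.ne
      simp only [S, if_neg (Finset.mem_compl.1 ha), if_neg (Finset.mem_compl.1 hb), if_pos hab,
        if_neg (not_lt.2 hab.le), Set.mem_Iio, Set.mem_Iic] at h1 h2
      linarith
    intro a ha b hb hab
    refine Set.disjoint_left.2 fun z hza hzb => ?_
    rcases lt_or_gt_of_ne hab with h | h
    · exact key a ha b hb h z hza hzb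
    · exact key b hb a ha h z hzb hza
  have hE : ∀ j ∈ Kᶜ, Measure.pi ν (E j) = ∫⁻ v, ENNReal.ofReal (g j v) := by
    intro j hj
    have hjK := Finset.mem_compl.1 hj
    rw [aux_section ν j (S j) (hEm j)]
    have hprod : ∀ v, ∏ l ∈ Finset.univ.erase j, ν l (S j l v)
        = ENNReal.ofReal ((∏ i ∈ K, (1 - stdGaussCDF ((v - μ i) / σ i))) *
          ∏ l ∈ Kᶜ.erase j, stdGaussCDF ((v - μ l) / σ l)) := by
      intro v
      have hu : Finset.univ.erase j = K ∪ Kᶜ.erase j := by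
        ext l
        by_cases h : l = j
        · simp [h, hjK]
        · simp [h, em]
      have hd : Disjoint K (Kᶜ.erase j) := by
        refine Finset.disjoint_left.2 fun l h1 h2 => ?_
        exact (Finset.mem_compl.1 (Finset.mem_of_mem_erase h2)) h1
      rw [hu, Finset.prod_union hd,
        ENNReal.ofReal_mul (Finset.prod_nonneg fun i _ => sub_nonneg.2 (aux_cdf_le_one _)),
        ENNReal.ofReal_prod_of_nonneg (fun i _ => sub_nonneg.2 (aux_cdf_le_one _)),
        ENNReal.ofReal_prod_of_nonneg (fun i _ => aux_cdf_nonneg _)]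
      congr 1
      · refine Finset.prod_congr rfl fun l hl => ?_
        simp only [S, if_pos hl, hν]
        exact aux_Ioi _ _ (hσ l) v
      · refine Finset.prod_congr rfl fun l hl => ?_
        simp only [S, if_neg (Finset.mem_compl.1 (Finset.mem_of_mem_erase hl)), hν]
        split_ifs
        · exact aux_Iio _ _ (hσ l) v
        · exact aux_Iic _ _ (hσ l) v
    simp only [hprod]
    rw [hν]
    simp only
    rw [gaussianReal_of_var_ne_zero _ (aux_var_ne _ (hσ j)),
      lintegral_withDensity_eq_lintegral_mul _ (measurable_gaussianPDF _ _) (by fun_prop)]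
    refine lintegral_congr fun v => ?_
    rw [Pi.mul_apply, gaussianPDF, ← ENNReal.ofReal_mul (gaussianPDFReal_nonneg _ _ _),
      aux_pdf _ _ (hσ j)]
    congr 1
    simp only [g]
    ring
  rw [hset, measure_biUnion_finset hdisj (fun j _ => hEm j), Finset.sum_congr rfl hE,
    ← lintegral_finsetSum _ (fun j _ => (hgm j).ennreal_ofReal)]
  have hfun : (fun v : ℝ => (∏ i ∈ K, (1 - stdGaussCDF ((v - μ i) / σ i))) *
      (∑ j ∈ Kᶜ, (1 / σ j) * stdGaussPDF ((v - μ j) / σ j) *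
        ∏ ℓ ∈ Kᶜ.erase j, stdGaussCDF ((v - μ ℓ) / σ ℓ))) = fun v => ∑ j ∈ Kᶜ, g j v := by
    funext v
    simp only [g, Finset.mul_sum]
  rw [hfun, integral_eq_lintegral_of_nonneg_ae
    (Filter.Eventually.of_forall fun v => Finset.sum_nonneg fun j _ => hg0 j v)
    (Finset.measurable_fun_sum _ fun j _ => hgm j).aestronglyMeasurable]
  congr 1
  refine lintegral_congr fun v => ?_
  rw [ENNReal.ofReal_sum_of_nonneg fun j _ => hg0 j v]
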